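/- Let S be a semidomain whose additive monoid is reduced (the only additively invertible element is 0). Then the polynomial semidomain S[x] has infinite elasticity, and moreover full elasticity: the set of elasticities {ρ(f) : f ∈ S[x]*} equals ℚ≥1 ∪ {∞}. In particular, for n ≥ 2 and k ≥ 1, the polynomial (x+n)^n(x²−x+1)(x+1)^k has exactly two factorizations, of lengths k+1 and k+n. -/

import Mathlib

open Polynomial

/-- A witness that the commutative semiring `S` embeds into an integral domain. -/
structure SemidomainWitness (S : Type) [CommSemiring S] : Type 1 where
  R : Type
  [commRing : CommRing R]
  [isDomain : IsDomain R]
  f : S →+* R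
  inj : Function.Injective f

/-- A semidomain is a commutative semiring that embeds into an integral domain. -/
def IsSemidomain (S : Type) [CommSemiring S] : Prop :=
  Nonempty (SemidomainWitness S)


/-- `l` is a factorization of `f` into irreducibles (up to a unit). -/
def IsFactorization {M : Type} [CommMonoidWithZero M] (l : Multiset M) (f : M) : Prop :=
  (∀ b ∈ l, Irreducible b) ∧ Associated l.prod f

/-- The set of lengths of factorizations of `f` into irreducibles. -/
def Lengths {M : Type} [CommMonoidWithZero M] (f : M) : Set ℕ :=
  {c : ℕ | ∃ l : Multiset M, IsFactorization l f ∧ Multiset.card l = c}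


section LinearFactors

/-- A multiset supported on four elements is a sum of four constant multisets. -/
theorem Multiset.exists_eq_replicate_four {α : Type*} {w x y z : α} {s : Multiset α}
    (h : ∀ t ∈ s, t = w ∨ t = x ∨ t = y ∨ t = z) :
    ∃ a b c d : ℕ, s = replicate a w + replicate b x + replicate c y + replicate d z := by
  induction s using Multiset.induction with
  | empty => exact ⟨0, 0, 0, 0, by simp⟩
  | cons t s ih =>
    obtain ⟨a, b, c, d, rfl⟩ := ih fun u hu => h u (mem_cons_of_mem hu)
    rcases h t (mem_cons_self t _) with rfl | rfl | rfl | rfl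
    · exact ⟨a + 1, b, c, d, by simp [replicate_succ]⟩
    · exact ⟨a, b + 1, c, d, by simp [replicate_succ]⟩
    · exact ⟨a, b, c + 1, d, by simp [replicate_succ]⟩
    · exact ⟨a, b, c, d + 1, by simp [replicate_succ]⟩

/-- The monic polynomial with roots `-m`, `-1`, `-ω`, `1 + ω` of prescribed multiplicities. -/
noncomputable def rootProduct {K : Type*} [Field K] (m : ℕ) (ω : K) (a b c d : ℕ) : K[X] :=
  (X - C (-(m : K))) ^ a * (X - C (-1)) ^ b * (X - C (-ω)) ^ c * (X - C (1 + ω)) ^ d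

variable {K : Type*} [Field K] {m : ℕ} {ω : K}

theorem rootProduct_mul (a b c d a' b' c' d' : ℕ) :
    rootProduct m ω a b c d * rootProduct m ω a' b' c' d' =
      rootProduct m ω (a + a') (b + b') (c + c') (d + d') := by
  simp only [rootProduct]
  ring

theorem rootProduct_monic (a b c d : ℕ) : (rootProduct m ω a b c d).Monic :=
  ((((monic_X_sub_C _).pow a).mul ((monic_X_sub_C _).pow b)).mul ((monic_X_sub_C _).pow c)).mul
    ((monic_X_sub_C _).pow d)

theorem roots_rootProduct (a b c d : ℕ) :
    (rootProduct m ω a b c d).roots = Multiset.replicate a (-(m : K)) + Multiset.replicate b (-1) +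
      Multiset.replicate c (-ω) + Multiset.replicate d (1 + ω) := by
  have h0 := (rootProduct_monic (m := m) (ω := ω) a b c d).ne_zero
  unfold rootProduct at h0 ⊢
  rw [roots_mul h0, roots_mul (left_ne_zero_of_mul h0),
    roots_mul (left_ne_zero_of_mul (left_ne_zero_of_mul h0))]
  simp only [roots_pow, roots_X_sub_C, Multiset.nsmul_singleton]

theorem rootProduct_le_of_dvd [CharZero K] (hm : 2 ≤ m) (hω : ω ^ 2 + ω + 1 = 0)
    {a b c d a' b' c' d' : ℕ}
    (h : rootProduct m ω a b c d ∣ rootProduct m ω a' b' c' d') :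
    a ≤ a' ∧ b ≤ b' ∧ c ≤ c' ∧ d ≤ d' := by
  have hle := roots.le_of_dvd (rootProduct_monic _ _ _ _).ne_zero h
  rw [roots_rootProduct, roots_rootProduct] at hle
  have hq : ((m ^ 2 + m + 1 : ℕ) : K) ≠ 0 := Nat.cast_ne_zero.2 (by positivity)
  have h3 : (3 : K) ≠ 0 := by norm_num
  push_cast at hq
  have e1 : (m : K) ≠ 1 := by exact_mod_cast (by omega : m ≠ 1)
  have e2 : (m : K) ≠ ω := fun e => hq (by rw [e]; exact hω)
  have e3 : -(m : K) ≠ 1 + ω := fun e => hq (by linear_combination hω + (ω - m) * e)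
  have e4 : (1 : K) ≠ ω := fun e => h3 (by rw [← e] at hω; linear_combination hω)
  have e5 : (-1 : K) ≠ 1 + ω := fun e => h3 (by linear_combination hω + (ω - 1) * e)
  have e6 : -ω ≠ 1 + ω := fun e => h3 (by linear_combination 4 * hω + (2 * ω + 1) * e)
  classical
  refine ⟨?_, ?_, ?_, ?_⟩
  · simpa [Multiset.count_replicate, e1, e2, e3, e4, e5, e6, e1.symm, e2.symm, e3.symm, e4.symm,
      e5.symm, e6.symm] using Multiset.count_le_of_le (-(m : K)) hle
  · simpa [Multiset.count_replicate, e1, e2, e3, e4, e5, e6, e1.symm, e2.symm, e3.symm, e4.symm,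
      e5.symm, e6.symm] using Multiset.count_le_of_le (-1 : K) hle
  · simpa [Multiset.count_replicate, e1, e2, e3, e4, e5, e6, e1.symm, e2.symm, e3.symm, e4.symm,
      e5.symm, e6.symm] using Multiset.count_le_of_le (-ω) hle
  · simpa [Multiset.count_replicate, e1, e2, e3, e4, e5, e6, e1.symm, e2.symm, e3.symm, e4.symm,
      e5.symm, e6.symm] using Multiset.count_le_of_le (1 + ω) hle

theorem rootProduct_inj [CharZero K] (hm : 2 ≤ m) (hω : ω ^ 2 + ω + 1 = 0)
    {a b c d a' b' c' d' : ℕ}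
    (h : rootProduct m ω a b c d = rootProduct m ω a' b' c' d') :
    a = a' ∧ b = b' ∧ c = c' ∧ d = d' := by
  have h1 := rootProduct_le_of_dvd hm hω h.dvd
  have h2 := rootProduct_le_of_dvd hm hω h.symm.dvd
  omega

theorem exists_eq_rootProduct_of_dvd [IsAlgClosed K] {p : K[X]} (hp : p.Monic) {a b c d : ℕ}
    (h : p ∣ rootProduct m ω a b c d) : ∃ a' b' c' d', p = rootProduct m ω a' b' c' d' := by
  have hle := roots.le_of_dvd (rootProduct_monic _ _ _ _).ne_zero h
  obtain ⟨a', b', c', d', hs⟩ := Multiset.exists_eq_replicate_four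
    (w := -(m : K)) (x := -1) (y := -ω) (z := 1 + ω) (s := p.roots) fun t ht => by
      have := Multiset.mem_of_le hle ht
      rw [roots_rootProduct] at this
      simp only [Multiset.mem_add] at this
      rcases this with ((this | this) | this) | this <;>
        simp [Multiset.eq_of_mem_replicate this]
  refine ⟨a', b', c', d', ?_⟩
  rw [(IsAlgClosed.splits p).eq_prod_roots_of_monic hp, hs]
  simp [rootProduct]

theorem quadratic_eq (hω : ω ^ 2 + ω + 1 = 0) :
    (X ^ 2 - X + 1 : K[X]) = (X - C (-ω)) * (X - C (1 + ω)) := by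
  have := congrArg (C : K → K[X]) hω
  simp only [map_add, map_pow, map_one, map_zero] at this
  simp only [map_neg, map_add, map_one]
  linear_combination this

theorem rootProduct_one_one (hω : ω ^ 2 + ω + 1 = 0) (a b : ℕ) :
    rootProduct m ω a b 1 1 = (X + C (m : K)) ^ a * (X + 1) ^ b * (X ^ 2 - X + 1) := by
  rw [quadratic_eq hω]
  simp only [rootProduct, map_neg, map_one, sub_neg_eq_add]
  ring

end LinearFactors

theorem Nat.choose_succ_mul_pow_le (n j : ℕ) :
    n ^ (n - (j + 1)) * n.choose (j + 1) ≤ n ^ (n - j) * n.choose j := by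
  rcases lt_or_ge j n with h | h
  · have h1 : n - j = n - (j + 1) + 1 := by omega
    have h2 := Nat.choose_succ_right_eq n j
    have h3 : n.choose (j + 1) ≤ n * n.choose j := by
      have : n.choose j * (n - j) ≤ n.choose j * n := Nat.mul_le_mul_left _ (Nat.sub_le _ _)
      nlinarith [Nat.zero_le (n.choose (j + 1) * j)]
    calc n ^ (n - (j + 1)) * n.choose (j + 1) ≤ n ^ (n - (j + 1)) * (n * n.choose j) :=
          Nat.mul_le_mul_left _ h3
      _ = n ^ (n - j) * n.choose j := by rw [h1, pow_succ]; ring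
  · simp [Nat.choose_eq_zero_of_lt (Nat.lt_succ_of_le h)]

/-- `(x + n)ⁿ (x² - x + 1)` has nonnegative coefficients. -/
theorem exists_natPolynomial (n : ℕ) (hn : 2 ≤ n) :
    ∃ A : ℕ[X], A.map (Nat.castRingHom ℤ) = (X + C (n : ℤ)) ^ n * (X ^ 2 - X + 1) := by
  rw [← mem_lifts, lifts_iff_coeff_lifts]
  intro i
  suffices h : 0 ≤ ((X + C (n : ℤ)) ^ n * (X ^ 2 - X + 1)).coeff i by
    obtain ⟨c, hc⟩ := Int.eq_ofNat_of_zero_le h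
    exact ⟨c, by rw [hc]; rfl⟩
  have hX : (X + C (n : ℤ)) ^ n * (X ^ 2 - X + 1) =
      (X + C (n : ℤ)) ^ n * X * X - (X + C (n : ℤ)) ^ n * X + (X + C (n : ℤ)) ^ n := by ring
  rw [hX]
  rcases i with _ | _ | j
  · simp only [coeff_add, coeff_sub, coeff_mul_X_zero, coeff_X_add_C_pow]
    positivity
  · simp only [coeff_add, coeff_sub, coeff_mul_X, coeff_mul_X_zero, coeff_X_add_C_pow]
    obtain ⟨k, rfl⟩ : ∃ k, n = k + 1 := ⟨n - 1, by omega⟩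
    simp [pow_succ]
  · simp only [coeff_add, coeff_sub, coeff_mul_X, coeff_X_add_C_pow]
    have h1 : (n : ℤ) ^ (n - (j + 1)) * n.choose (j + 1) ≤ (n : ℤ) ^ (n - j) * n.choose j := by
      exact_mod_cast Nat.choose_succ_mul_pow_le n j
    have h2 : (0 : ℤ) ≤ (n : ℤ) ^ (n - (j + 1 + 1)) * n.choose (j + 1 + 1) := by positivity
    linarith

section ReducedSemidomain

variable {S K : Type} [CommSemiring S] [Field K] {φ : S →+* K}

theorem charZero_of_reduced (hφ : Function.Injective φ)
    (hred : ∀ a b : S, a + b = 0 → a = 0) : CharZero K := by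
  refine charZero_of_inj_zero fun n hn => ?_
  rcases n with _ | n
  · rfl
  · have h : (1 : S) + n = 0 := hφ (by rw [map_zero, ← hn]; simp [add_comm])
    have h1 := congrArg φ (hred 1 n h)
    simp at h1

theorem natCast_ne_zero_of_injective [CharZero K] (φ : S →+* K) {n : ℕ} (hn : n ≠ 0) :
    (n : S) ≠ 0 := fun h => by
  have := congrArg φ h
  rw [map_natCast, map_zero] at this
  exact hn (by exact_mod_cast this)

theorem neg_natCast_ne_map [CharZero K] (hφ : Function.Injective φ)
    (hred : ∀ a b : S, a + b = 0 → a = 0) {n : ℕ} (hn : n ≠ 0) (s : S) : φ s ≠ -(n : K) :=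
  fun h => natCast_ne_zero_of_injective φ hn
    (hred n s (hφ (by rw [map_add, map_natCast, map_zero, h]; ring)))

theorem natCast_mul_ne_map [CharZero K] (hφ : Function.Injective φ)
    (hred : ∀ a b : S, a + b = 0 → a = 0) {ω : K} (hω : ω ^ 2 + ω + 1 = 0) {n : ℕ} (hn : n ≠ 0)
    (s : S) : φ s ≠ n * ω := fun h => by
  refine natCast_ne_zero_of_injective φ (pow_ne_zero 2 hn)
    (hred _ (n * s + s ^ 2) (hφ ?_))
  simp only [map_add, map_mul, map_pow, map_natCast, map_zero, h]
  push_cast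
  linear_combination (n : K) ^ 2 * hω

variable {m : ℕ} {ω : K}

/-- The multiplicities of the roots of a polynomial over a reduced semidomain. -/
theorem multiplicities_of_map_eq [CharZero K] (hφ : Function.Injective φ)
    (hred : ∀ a b : S, a + b = 0 → a = 0) (hm : 2 ≤ m) (hω : ω ^ 2 + ω + 1 = 0)
    {p : S[X]} {a b c d : ℕ} (h : p.map φ = rootProduct m ω a b c d) (hc : c ≤ 1) (hd : d ≤ 1) :
    (c = 0 ∧ d = 0) ∨ (c = 1 ∧ d = 1 ∧ (1 ≤ b ∨ m ≤ a)) := by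
  have h0 : φ (p.coeff 0) = (m : K) ^ a * ω ^ c * (-1 - ω) ^ d := by
    rw [← coeff_map, h, coeff_zero_eq_eval_zero]
    simp only [rootProduct, eval_mul, eval_pow, eval_sub, eval_X, eval_C]
    ring
  have hma : m ^ a ≠ 0 := pow_ne_zero _ (by omega)
  interval_cases c <;> interval_cases d
  · simp
  · exact absurd (by rw [h0]; push_cast; ring)
      (natCast_mul_ne_map hφ hred (ω := -1 - ω) (by linear_combination hω) hma (p.coeff 0))
  · exact absurd (by rw [h0]; push_cast; ring)
      (natCast_mul_ne_map hφ hred hω hma (p.coeff 0))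
  · refine Or.inr ⟨rfl, rfl, ?_⟩
    by_contra! hcon
    obtain rfl : b = 0 := by omega
    have e : (X + C (m : K)) ^ a * (X + 1) ^ 0 * (X ^ 2 - X + 1) =
      (X + C (m : K)) ^ a * X * X - (X + C (m : K)) ^ a * X + (X + C (m : K)) ^ a := by ring
    have h1 : φ (p.coeff 1) = ((X + C (m : K)) ^ a * X * X - (X + C (m : K)) ^ a * X +
        (X + C (m : K)) ^ a).coeff 1 := by
      rw [← coeff_map, h, rootProduct_one_one hω, e]
    simp only [coeff_add, coeff_sub, coeff_mul_X, coeff_mul_X_zero, coeff_X_add_C_pow] at h1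
    rcases a with _ | a
    · exact neg_natCast_ne_map hφ hred one_ne_zero (p.coeff 1) (by simp [h1])
    · have hma' : m ^ a * (m - (a + 1)) ≠ 0 :=
        mul_ne_zero (pow_ne_zero _ (by omega)) (by omega)
      refine neg_natCast_ne_map hφ hred hma' (p.coeff 1) ?_
      rw [Nat.cast_mul, Nat.cast_sub hcon.2.le, h1]
      simp [pow_succ]
      ring

theorem monic_of_map_eq_rootProduct (hφ : Function.Injective φ) {p : S[X]} {a b c d : ℕ}
    (h : p.map φ = rootProduct m ω a b c d) : p.Monic :=
  monic_of_injective hφ (h ▸ rootProduct_monic a b c d)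

/-- Irreducibility of a monic polynomial over a subsemiring, read off from its roots. -/
theorem irreducible_of_map_eq_rootProduct [IsAlgClosed K] (hφ : Function.Injective φ) {p : S[X]}
    {a b c d : ℕ} (hp : p.map φ = rootProduct m ω a b c d) (hp1 : p ≠ 1)
    (h : ∀ (g g' : S[X]) (a₁ b₁ c₁ d₁ a₂ b₂ c₂ d₂ : ℕ), g.map φ = rootProduct m ω a₁ b₁ c₁ d₁ →
      g'.map φ = rootProduct m ω a₂ b₂ c₂ d₂ →
      rootProduct m ω (a₁ + a₂) (b₁ + b₂) (c₁ + c₂) (d₁ + d₂) = rootProduct m ω a b c d →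
      (a₁ = 0 ∧ b₁ = 0 ∧ c₁ = 0 ∧ d₁ = 0) ∨ (a₂ = 0 ∧ b₂ = 0 ∧ c₂ = 0 ∧ d₂ = 0)) :
    Irreducible p := by
  have : NoZeroDivisors S := hφ.noZeroDivisors φ (map_zero φ) (map_mul φ)
  rw [irreducible_of_monic (monic_of_map_eq_rootProduct hφ hp) hp1]
  intro g g' hg hg' hgg
  have hmul : g.map φ * g'.map φ = rootProduct m ω a b c d := by
    rw [← Polynomial.map_mul, hgg, hp]
  obtain ⟨a₁, b₁, c₁, d₁, h₁⟩ := exists_eq_rootProduct_of_dvd (hg.map φ) (Dvd.intro _ hmul)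
  obtain ⟨a₂, b₂, c₂, d₂, h₂⟩ := exists_eq_rootProduct_of_dvd (hg'.map φ) (Dvd.intro_left _ hmul)
  rw [h₁, h₂, rootProduct_mul] at hmul
  rcases h g g' _ _ _ _ _ _ _ _ h₁ h₂ hmul with ⟨rfl, rfl, rfl, rfl⟩ | ⟨rfl, rfl, rfl, rfl⟩
  · exact Or.inl (map_injective φ hφ (by rw [h₁]; simp [rootProduct]))
  · exact Or.inr (map_injective φ hφ (by rw [h₂]; simp [rootProduct]))

theorem map_X_add_natCast : (X + C (m : S)).map φ = rootProduct m ω 1 0 0 0 := by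
  simp [rootProduct]

theorem map_X_add_one : (X + 1 : S[X]).map φ = rootProduct m ω 0 1 0 0 := by
  simp [rootProduct]

theorem map_X_pow_three_add_one (hω : ω ^ 2 + ω + 1 = 0) :
    (X ^ 3 + 1 : S[X]).map φ = rootProduct m ω 0 1 1 1 := by
  rw [rootProduct_one_one hω]
  simp only [Polynomial.map_add, Polynomial.map_pow, map_X, Polynomial.map_one]
  ring

theorem ne_one_of_map_eq_rootProduct [CharZero K] (hm : 2 ≤ m) (hω : ω ^ 2 + ω + 1 = 0) {p : S[X]}
    {a b c d : ℕ} (hp : p.map φ = rootProduct m ω a b c d) (h : 0 < a + b + c + d) : p ≠ 1 := by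
  rintro rfl
  have h1 : rootProduct m ω a b c d = rootProduct m ω 0 0 0 0 := by
    rw [← hp]; simp [rootProduct]
  have := rootProduct_inj hm hω h1
  omega

/-- The four polynomials that occur in the factorizations are irreducible. -/
theorem irreducible_of_mem_atoms [CharZero K] [IsAlgClosed K]
    (hφ : Function.Injective φ)
    (hred : ∀ a b : S, a + b = 0 → a = 0) (hm : 2 ≤ m) (hω : ω ^ 2 + ω + 1 = 0)
    {A p : S[X]} (hA : A.map φ = rootProduct m ω m 0 1 1)
    (hp : p = X + C (m : S) ∨ p = X + 1 ∨ p = X ^ 3 + 1 ∨ p = A) : Irreducible p := by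
  obtain ⟨a, b, c, h, habc⟩ : ∃ a b c, p.map φ = rootProduct m ω a b c c ∧
      (a = 1 ∧ b = 0 ∧ c = 0 ∨ a = 0 ∧ b = 1 ∧ c = 0 ∨ a = 0 ∧ b = 1 ∧ c = 1 ∨
        a = m ∧ b = 0 ∧ c = 1) := by
    rcases hp with rfl | rfl | rfl | rfl
    · exact ⟨1, 0, 0, map_X_add_natCast, by simp⟩
    · exact ⟨0, 1, 0, map_X_add_one, by simp⟩
    · exact ⟨0, 1, 1, map_X_pow_three_add_one hω, by simp⟩
    · exact ⟨m, 0, 1, hA, by simp⟩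
  refine irreducible_of_map_eq_rootProduct hφ h
    (ne_one_of_map_eq_rootProduct hm hω h (by omega)) ?_
  intro g g' a₁ b₁ c₁ d₁ a₂ b₂ c₂ d₂ h₁ h₂ h₃
  have hsum := rootProduct_inj hm hω h₃
  have k₁ := multiplicities_of_map_eq hφ hred hm hω h₁ (by omega) (by omega)
  have k₂ := multiplicities_of_map_eq hφ hred hm hω h₂ (by omega) (by omega)
  omega

theorem eq_of_irreducible_of_map_eq [CharZero K] (hφ : Function.Injective φ) (hm : 2 ≤ m)
    (hω : ω ^ 2 + ω + 1 = 0) {p q r : S[X]} (hp : Irreducible p) (hr : r.Monic) {a b c d : ℕ}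
    (hq : q.map φ = rootProduct m ω a b c d) (h : 0 < a + b + c + d)
    (hpqr : p.map φ = q.map φ * r.map φ) : p = q := by
  have he : p = q * r := map_injective φ hφ (by rw [hpqr, Polynomial.map_mul])
  rcases hp.isUnit_or_isUnit he with hu | hu
  · exact absurd ((monic_of_map_eq_rootProduct hφ hq).eq_one_of_isUnit hu)
      (ne_one_of_map_eq_rootProduct hm hω hq h)
  · rw [he, hr.eq_one_of_isUnit hu, mul_one]

/-- A monic irreducible divisor is one of four polynomials. -/
theorem mem_atoms_of_irreducible_of_dvd [CharZero K] [IsAlgClosed K]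
    (hφ : Function.Injective φ)
    (hred : ∀ a b : S, a + b = 0 → a = 0) (hm : 2 ≤ m) (hω : ω ^ 2 + ω + 1 = 0)
    {A p : S[X]} (hA : A.map φ = rootProduct m ω m 0 1 1) {a b : ℕ} (hp : p.Monic)
    (hirr : Irreducible p) (hdvd : p.map φ ∣ rootProduct m ω a b 1 1) :
    p = X + C (m : S) ∨ p = X + 1 ∨ p = X ^ 3 + 1 ∨ p = A := by
  obtain ⟨a', b', c', d', h⟩ := exists_eq_rootProduct_of_dvd (hp.map φ) hdvd
  have hle := rootProduct_le_of_dvd hm hω (h ▸ hdvd)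
  have hN (i : ℕ) : ((X + C (m : S)) ^ i).map φ = rootProduct m ω i 0 0 0 := by
    simp [rootProduct]
  have hO (i : ℕ) : ((X + 1 : S[X]) ^ i).map φ = rootProduct m ω 0 i 0 0 := by
    simp [rootProduct]
  have hNm (i : ℕ) : ((X + C (m : S)) ^ i).Monic := monic_of_map_eq_rootProduct hφ (hN i)
  have hOm (i : ℕ) : ((X + 1 : S[X]) ^ i).Monic := monic_of_map_eq_rootProduct hφ (hO i)
  have key {q : S[X]} {i j c d : ℕ} (u v : ℕ) (hq : q.map φ = rootProduct m ω i j c d)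
      (h0 : 0 < i + j + c + d) (h1 : a' = i + u) (h2 : b' = j + v) (h3 : c' = c)
      (h4 : d' = d) : p = q := by
    refine eq_of_irreducible_of_map_eq hφ hm hω hirr ((hNm u).mul (hOm v)) hq h0 ?_
    rw [Polynomial.map_mul, hN, hO, hq, h, rootProduct_mul, rootProduct_mul]
    congr 1
    all_goals omega
  rcases multiplicities_of_map_eq hφ hred hm hω h hle.2.2.1 hle.2.2.2 with
    ⟨rfl, rfl⟩ | ⟨rfl, rfl, hb | ha⟩
  · rcases Nat.eq_zero_or_pos a' with rfl | ha
    · rcases Nat.eq_zero_or_pos b' with rfl | hb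
      · exact absurd (map_injective φ hφ (by rw [h]; simp [rootProduct])) hirr.ne_one
      · exact Or.inr (Or.inl (key 0 (b' - 1) map_X_add_one (by simp) (by omega) (by omega)
          rfl rfl))
    · exact Or.inl (key (a' - 1) b' map_X_add_natCast (by simp) (by omega) (by omega) rfl rfl)
  · exact Or.inr (Or.inr (Or.inl (key a' (b' - 1) (map_X_pow_three_add_one hω) (by simp)
      (by omega) (by omega) rfl rfl)))
  · exact Or.inr (Or.inr (Or.inr (key (a' - m) b' hA (by simp) (by omega) (by omega) rfl rfl)))

theorem exists_monic_associated_of_dvd {R : Type*} [CommSemiring R] [NoZeroDivisors R]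
    {p f : R[X]} (hf : f.Monic) (h : p ∣ f) : ∃ q : R[X], q.Monic ∧ Associated p q := by
  obtain ⟨r, rfl⟩ := h
  have h1 : p.leadingCoeff * r.leadingCoeff = 1 := by rw [← leadingCoeff_mul]; exact hf
  have hu : IsUnit (C r.leadingCoeff) := (IsUnit.of_mul_eq_one_right _ h1).map C
  exact ⟨p * C r.leadingCoeff, by rw [Monic, leadingCoeff_mul, leadingCoeff_C, h1],
    hu.unit, rfl⟩

/-- The factorizations of `A (x + 1)ᵏ` up to associates. -/
theorem rel_of_isFactorization [CharZero K] [IsAlgClosed K]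
    (hφ : Function.Injective φ)
    (hred : ∀ a b : S, a + b = 0 → a = 0) (hm : 2 ≤ m) (hω : ω ^ 2 + ω + 1 = 0)
    {A : S[X]} (hA : A.map φ = rootProduct m ω m 0 1 1) {k : ℕ} (hk : 1 ≤ k)
    {l : Multiset S[X]} (hl : IsFactorization l (A * (X + 1) ^ k)) :
    Multiset.Rel Associated l (A ::ₘ Multiset.replicate k (X + 1)) ∨
    Multiset.Rel Associated l ((X ^ 3 + 1) ::ₘ
      (Multiset.replicate m (X + C (m : S)) + Multiset.replicate (k - 1) (X + 1))) := by
  have : NoZeroDivisors S := hφ.noZeroDivisors φ (map_zero φ) (map_mul φ)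
  have hF : (A * (X + 1) ^ k).map φ = rootProduct m ω m k 1 1 := by
    rw [Polynomial.map_mul, hA, Polynomial.map_pow]
    simp [rootProduct]
    ring
  have hFm := monic_of_map_eq_rootProduct hφ hF
  have hex (p : S[X]) : ∃ q : S[X], p ∈ l → Associated p q ∧
      (q = X + C (m : S) ∨ q = X + 1 ∨ q = X ^ 3 + 1 ∨ q = A) := by
    by_cases hp : p ∈ l
    · have hd : p ∣ A * (X + 1) ^ k := (Multiset.dvd_prod hp).trans hl.2.dvd
      obtain ⟨q, hq, hpq⟩ := exists_monic_associated_of_dvd hFm hd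
      refine ⟨q, fun _ => ⟨hpq, mem_atoms_of_irreducible_of_dvd (a := m) (b := k) hφ hred hm hω
        hA hq (hpq.irreducible (hl.1 p hp)) ?_⟩⟩
      rw [← hF]
      exact Polynomial.map_dvd φ (hpq.symm.dvd.trans hd)
    · exact ⟨p, fun h => absurd h hp⟩
  choose g hg using hex
  have hrel : Multiset.Rel Associated l (l.map g) :=
    Multiset.rel_map_right.2 (Multiset.rel_refl_of_refl_on fun p hp => (hg p hp).1)
  obtain ⟨a, b, c, d, hs⟩ := Multiset.exists_eq_replicate_four (s := l.map g) fun q hq => by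
    obtain ⟨p, hp, rfl⟩ := Multiset.mem_map.1 hq
    exact (hg p hp).2
  have hprod : (l.map g).prod.map φ = rootProduct m ω (a + m * d) (b + c) (c + d) (c + d) := by
    rw [hs]
    simp only [Multiset.prod_add, Multiset.prod_replicate, Polynomial.map_mul,
      Polynomial.map_pow, hA, map_X_add_natCast (m := m) (ω := ω),
      map_X_add_one (m := m) (ω := ω), map_X_pow_three_add_one (m := m) hω]
    simp only [rootProduct, pow_zero, pow_one, one_mul, mul_one, mul_pow, ← pow_mul, pow_add]
    ring
  have hass : Associated l.prod (l.map g).prod := by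
    rw [← Associates.mk_eq_mk_iff_associated, ← Associates.prod_mk, ← Associates.prod_mk,
      Associates.rel_associated_iff_map_eq_map.1 hrel]
  have heq := eq_of_monic_of_associated (monic_of_map_eq_rootProduct hφ hprod) hFm
    (hass.symm.trans hl.2)
  rw [heq, hF] at hprod
  obtain ⟨h1, h2, h3, -⟩ := rootProduct_inj hm hω hprod
  rcases Nat.eq_zero_or_pos d with rfl | hd
  · obtain rfl : c = 1 := by omega
    obtain rfl : a = m := by omega
    obtain rfl : b = k - 1 := by omega
    right
    rw [hs] at hrel
    convert hrel using 1
    rw [← Multiset.singleton_add]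
    simp only [Multiset.replicate_one, Multiset.replicate_zero, add_zero]
    abel
  · obtain rfl : d = 1 := by omega
    obtain rfl : c = 0 := by omega
    obtain rfl : a = 0 := by omega
    obtain rfl : b = k := by omega
    left
    rw [hs] at hrel
    convert hrel using 1
    rw [← Multiset.singleton_add]
    simp only [Multiset.replicate_one, Multiset.replicate_zero, add_zero]
    abel

end ReducedSemidomain

theorem exists_injective_algClosed {S : Type} [CommSemiring S] (hS : IsSemidomain S) :
    ∃ (K : Type) (_ : Field K) (_ : IsAlgClosed K) (φ : S →+* K), Function.Injective φ := by
  obtain ⟨R, f, hf⟩ := hS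
  exact ⟨AlgebraicClosure (FractionRing R), inferInstance, inferInstance,
    (algebraMap (FractionRing R) _).comp ((algebraMap R (FractionRing R)).comp f),
    (algebraMap (FractionRing R) _).injective.comp
      ((IsFractionRing.injective R (FractionRing R)).comp hf)⟩

/-- The element `A (x + 1)ᵏ` has exactly two factorizations, of lengths `k + 1` and `k + n`. -/
theorem exists_factorization_data {S : Type} [CommSemiring S] (hS : IsSemidomain S)
    (hred : ∀ a b : S, a + b = 0 → a = 0) (n k : ℕ) (hn : 2 ≤ n) (hk : 1 ≤ k) :
    ∃ A : S[X], A * (X + 1) = (X + C (n : S)) ^ n * (X ^ 3 + 1) ∧ A * (X + 1) ^ k ≠ 0 ∧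
      Lengths (A * (X + 1) ^ k) = ({k + 1, k + n} : Set ℕ) ∧
      ∀ l m : Multiset S[X],
        IsFactorization l (A * (X + 1) ^ k) → IsFactorization m (A * (X + 1) ^ k) →
        Multiset.card l = Multiset.card m → Multiset.Rel Associated l m := by
  obtain ⟨K, _, _, φ, hφ⟩ := exists_injective_algClosed hS
  have := charZero_of_reduced hφ hred
  obtain ⟨ω, hω⟩ : ∃ ω : K, ω ^ 2 + ω + 1 = 0 := by
    obtain ⟨ω, hω⟩ := IsAlgClosed.exists_root (X ^ 2 + X + 1 : K[X])
      (by rw [show (X ^ 2 + X + 1 : K[X]).degree = 2 by compute_degree!]; norm_num)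
    exact ⟨ω, by simpa [IsRoot] using hω⟩
  obtain ⟨B, hB⟩ := exists_natPolynomial n hn
  have hA : (B.map (Nat.castRingHom S)).map φ = rootProduct n ω n 0 1 1 := by
    rw [rootProduct_one_one hω, Polynomial.map_map,
      show φ.comp (Nat.castRingHom S) = (Int.castRingHom K).comp (Nat.castRingHom ℤ) from
        Subsingleton.elim _ _, ← Polynomial.map_map, hB]
    simp
  generalize B.map (Nat.castRingHom S) = A at hA
  have hmul : A * (X + 1) = (X + C (n : S)) ^ n * (X ^ 3 + 1) := by
    apply map_injective φ hφ
    rw [Polynomial.map_mul, Polynomial.map_mul, Polynomial.map_pow, hA,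
      map_X_add_one (m := n) (ω := ω), map_X_add_natCast (ω := ω),
      map_X_pow_three_add_one (m := n) hω]
    simp only [rootProduct]
    ring
  have hrel (l : Multiset S[X]) (hl : IsFactorization l (A * (X + 1) ^ k)) :=
    rel_of_isFactorization hφ hred hn hω hA hk hl
  have hatom {p : S[X]} := irreducible_of_mem_atoms (p := p) hφ hred hn hω hA
  refine ⟨A, hmul, ?_, ?_, ?_⟩
  · have := φ.domain_nontrivial
    exact ((monic_of_map_eq_rootProduct hφ hA).mul ((monic_X_add_C (1 : S)).pow k)).ne_zero
  · ext c
    constructor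
    · rintro ⟨l, hl, rfl⟩
      rcases hrel l hl with h | h
      · left
        rw [Multiset.card_eq_card_of_rel h]
        simp
      · right
        rw [Set.mem_singleton_iff, Multiset.card_eq_card_of_rel h]
        simp only [Multiset.card_cons, Multiset.card_add, Multiset.card_replicate]
        omega
    · rintro (rfl | rfl)
      · refine ⟨A ::ₘ Multiset.replicate k (X + 1), ⟨fun p hp => hatom ?_, ?_⟩, by simp⟩
        · rcases Multiset.mem_cons.1 hp with rfl | hp
          · simp
          · simp [Multiset.eq_of_mem_replicate hp]
        · simp
      · refine ⟨(X ^ 3 + 1) ::ₘ (Multiset.replicate n (X + C (n : S)) +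
          Multiset.replicate (k - 1) (X + 1)), ⟨fun p hp => hatom ?_, ?_⟩, ?_⟩
        · rcases Multiset.mem_cons.1 hp with rfl | hp
          · simp
          · rcases Multiset.mem_add.1 hp with hp | hp <;> simp [Multiset.eq_of_mem_replicate hp]
        · rw [Multiset.prod_cons, Multiset.prod_add, Multiset.prod_replicate,
            Multiset.prod_replicate, ← mul_assoc, mul_comm (X ^ 3 + 1), ← hmul, mul_assoc,
            ← pow_succ', Nat.sub_add_cancel hk]
          exact Associated.refl _
        · simp only [Multiset.card_cons, Multiset.card_add, Multiset.card_replicate]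
          omega
  · intro l m hl hm hcard
    have hcl {s t : Multiset S[X]} (h : Multiset.Rel Associated s t) :=
      Associates.rel_associated_iff_map_eq_map.1 h
    rw [Associates.rel_associated_iff_map_eq_map]
    rcases hrel l hl with h | h <;> rcases hrel m hm with h' | h'
    · rw [hcl h, hcl h']
    · rw [Multiset.card_eq_card_of_rel h, Multiset.card_eq_card_of_rel h'] at hcard
      simp only [Multiset.card_cons, Multiset.card_add, Multiset.card_replicate] at hcard
      omega
    · rw [Multiset.card_eq_card_of_rel h, Multiset.card_eq_card_of_rel h'] at hcard
      simp only [Multiset.card_cons, Multiset.card_add, Multiset.card_replicate] at hcard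
      omega
    · rw [hcl h, hcl h']

theorem lengths_eq_singleton_of_irreducible {M : Type} [CommMonoidWithZero M] {p : M}
    (hp : Irreducible p) : Lengths p = {1} := by
  ext c
  constructor
  · rintro ⟨l, ⟨hl, hass⟩, rfl⟩
    have hirr := hass.symm.irreducible hp
    induction l using Multiset.induction with
    | empty => simp at hirr
    | cons a s _ =>
      rw [Multiset.prod_cons] at hirr
      rcases hirr.isUnit_or_isUnit rfl with hu | hu
      · exact absurd hu (hl a (Multiset.mem_cons_self a s)).not_isUnit
      · obtain rfl : s = 0 := Multiset.eq_zero_of_forall_notMem fun b hb =>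
          (hl b (Multiset.mem_cons_of_mem hb)).not_isUnit
            (isUnit_of_dvd_unit (Multiset.dvd_prod hb) hu)
        simp
  · rintro rfl
    exact ⟨{p}, ⟨by simpa using hp, by simp⟩, by simp⟩

theorem irreducible_X_of_noZeroDivisors {R : Type*} [CommSemiring R] [NoZeroDivisors R]
    [Nontrivial R] : Irreducible (X : R[X]) := by
  rw [monic_X.irreducible_iff_natDegree]
  refine ⟨fun h => by simpa using congrArg natDegree h, fun f g hf hg h => ?_⟩
  have := hf.natDegree_mul hg
  rw [h, natDegree_X] at this
  omega

/-- Every rational number `q ≥ 1` is the elasticity of a polynomial. -/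
theorem exists_lengths_eq_pair {S : Type} [CommSemiring S] (hS : IsSemidomain S)
    (hred : ∀ a b : S, a + b = 0 → a = 0) (q : ℚ) (hq : 1 ≤ q) :
    ∃ f : S[X], f ≠ 0 ∧ ∃ a b : ℕ,
      0 < a ∧ a ≤ b ∧ Lengths f = {a, b} ∧ (b : ℚ) / (a : ℚ) = q := by
  rcases hq.eq_or_lt with rfl | hq
  · obtain ⟨R, f, hf⟩ := hS
    have : NoZeroDivisors S := hf.noZeroDivisors f (map_zero f) (map_mul f)
    have : Nontrivial S := f.domain_nontrivial
    exact ⟨X, X_ne_zero, 1, 1, one_pos, le_rfl, by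
      rw [lengths_eq_singleton_of_irreducible irreducible_X_of_noZeroDivisors]; simp, by simp⟩
  · obtain ⟨u, hu⟩ := Int.eq_ofNat_of_zero_le (Rat.num_nonneg.2 (by linarith : (0 : ℚ) ≤ q))
    have hd : 0 < q.den := q.den_pos
    have hd' : (0 : ℚ) < q.den := by exact_mod_cast hd
    have hqu : (u : ℚ) / q.den = q := by
      conv_rhs => rw [← Rat.num_div_den q, hu]
      simp
    have hlt : q.den < u := by
      rw [← hqu, one_lt_div hd'] at hq
      exact_mod_cast hq
    obtain ⟨A, -, h0, hlen, -⟩ := exists_factorization_data hS hred (2 * (u - q.den) + 1)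
      (2 * q.den - 1) (by omega) (by omega)
    refine ⟨_, h0, 2 * q.den, 2 * u, by omega, by omega, ?_, ?_⟩
    · rw [hlen]
      congr 2 <;> omega
    · refine Eq.trans ?_ hqu
      push_cast
      exact mul_div_mul_left _ _ two_ne_zero

/-- Let `S` be a semidomain whose additive monoid is reduced. Then `S[x]` has infinite
elasticity (elements with factorizations whose length ratio is arbitrarily large) and full
elasticity (every rational `q ≥ 1` is the elasticity of some element, whose set of lengths is
`{a, b}` with `b/a = q`). In particular, for `n ≥ 2` and `k ≥ 1` the polynomial
`(x+n)ⁿ(x²−x+1)(x+1)ᵏ` (here written via `A·(x+1) = (x+n)ⁿ(x³+1)`) has exactly two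
factorizations, of lengths `k+1` and `k+n`. -/
theorem stmt19 (S : Type) [CommSemiring S] (hS : IsSemidomain S)
    (hred : ∀ a b : S, a + b = 0 → a = 0) :
    (∀ M : ℚ, ∃ f : Polynomial S, f ≠ 0 ∧ ∃ a b : ℕ,
      a ∈ Lengths f ∧ b ∈ Lengths f ∧ 0 < a ∧ M < (b : ℚ) / (a : ℚ)) ∧
    (∀ q : ℚ, 1 ≤ q → ∃ f : Polynomial S, f ≠ 0 ∧ ∃ a b : ℕ,
      0 < a ∧ a ≤ b ∧ Lengths f = {a, b} ∧ (b : ℚ) / (a : ℚ) = q) ∧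
    (∀ n k : ℕ, 2 ≤ n → 1 ≤ k → ∃ A : Polynomial S,
      A * (X + 1) = (X + C (n : S)) ^ n * (X ^ 3 + 1) ∧
      Lengths (A * (X + 1) ^ k) = ({k + 1, k + n} : Set ℕ) ∧
      ∀ l m : Multiset (Polynomial S),
        IsFactorization l (A * (X + 1) ^ k) → IsFactorization m (A * (X + 1) ^ k) →
        Multiset.card l = Multiset.card m → Multiset.Rel Associated l m) := by
  refine ⟨fun M => ?_, exists_lengths_eq_pair hS hred, fun n k hn hk => ?_⟩
  · obtain ⟨f, hf, a, b, ha, -, hlen, hq⟩ :=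
      exists_lengths_eq_pair hS hred (max M 0 + 1) (by linarith [le_max_right M 0])
    exact ⟨f, hf, a, b, by simp [hlen], by simp [hlen], ha,
      by rw [hq]; linarith [le_max_left M 0]⟩
  · obtain ⟨A, h1, -, h2, h3⟩ := exists_factorization_data hS hred n k hn hk
    exact ⟨A, h1, h2, h3⟩
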